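/- arXiv:math-ph/0005030 — 7 statements merged into one kernel-verified Lean document; each statement's English description precedes it below -/
import Mathlib

section
/- For x, x' ∈ ℝ set ℓ(x,x') := max{0, min(|x|,|x'|)·sgn(x x')} and m(x,x') := max{|x|,|x'|}. Let f : ℝ → ℝ be Lebesgue measurable with ∫_ℝ |x| |f(x)| dx < ∞. For κ > 0 define the kernels A_κ(x,x') := (|f(x)| |f(x')|)^{1/2} · e^{−κ m(x,x')} · sinh(κ ℓ(x,x'))/κ and A₀(x,x') := (|f(x)| |f(x')|)^{1/2} · ℓ(x,x'). Then ∫_{ℝ²} |A_κ(x,x') − A₀(x,x')|² dx dx' → 0 as κ → 0+. -/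
open MeasureTheory

/-- For `0 ≤ l ≤ m`, the quantity `e^{-κm} sinh(κl) / κ` lies between `0` and `l`. -/
lemma exp_mul_sinh_div_mem_Icc {κ l m : ℝ} (hκ : 0 < κ) (hl : 0 ≤ l) (hlm : l ≤ m) :
    Real.exp (-κ * m) * Real.sinh (κ * l) / κ ∈ Set.Icc 0 l := by
  have hκl : 0 ≤ κ * l := mul_nonneg hκ.le hl
  have hsinh : 0 ≤ Real.sinh (κ * l) := Real.sinh_nonneg_iff.2 hκl
  refine ⟨by positivity, ?_⟩
  rw [div_le_iff₀ hκ]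
  calc Real.exp (-κ * m) * Real.sinh (κ * l)
      ≤ Real.exp (-(κ * l)) * Real.sinh (κ * l) := by
        gcongr
        nlinarith
    _ = (1 - Real.exp (-(2 * (κ * l)))) / 2 := by
        have h₁ : Real.exp (-(κ * l)) * Real.exp (κ * l) = 1 := by
          rw [← Real.exp_add]; simp
        have h₂ : Real.exp (-(κ * l)) * Real.exp (-(κ * l)) = Real.exp (-(2 * (κ * l))) := by
          rw [← Real.exp_add]; ring_nf
        rw [Real.sinh_eq]
        linear_combination (1 / 2) * h₁ - (1 / 2) * h₂
    _ ≤ l * κ := by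
        linarith [Real.add_one_le_exp (-(2 * (κ * l)))]

lemma tendsto_exp_mul_sinh_div (l m : ℝ) :
    Filter.Tendsto (fun κ : ℝ => Real.exp (-κ * m) * Real.sinh (κ * l) / κ)
      (nhdsWithin 0 (Set.Ioi 0)) (nhds l) := by
  have hderiv : HasDerivAt (fun κ : ℝ => Real.exp (-κ * m) * Real.sinh (κ * l)) l 0 := by
    have h₁ : HasDerivAt (fun κ : ℝ => Real.exp (-κ * m)) _ 0 :=
      ((hasDerivAt_id (0 : ℝ)).neg.mul_const m).exp
    have h₂ : HasDerivAt (fun κ : ℝ => Real.sinh (κ * l)) _ 0 :=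
      ((hasDerivAt_id (0 : ℝ)).mul_const l).sinh
    exact (h₁.mul h₂).congr_deriv (by simp)
  have hslope := hderiv.tendsto_slope.mono_left
    (nhdsWithin_mono 0 fun x (hx : 0 < x) => hx.ne')
  refine hslope.congr fun κ => ?_
  simp [slope_def_field]

lemma max_zero_min_mul_sign_le_min (x y : ℝ) :
    max 0 (min |x| |y| * Real.sign (x * y)) ≤ min |x| |y| := by
  have hmin : 0 ≤ min |x| |y| := le_min (abs_nonneg x) (abs_nonneg y)
  refine max_le hmin (mul_le_of_le_one_right hmin ?_)
  rcases Real.sign_apply_eq (x * y) with h | h | h <;> norm_num [h]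

lemma measurable_real_sign : Measurable Real.sign :=
  Measurable.ite measurableSet_Iio measurable_const
    (Measurable.ite measurableSet_Ioi measurable_const measurable_const)

/-- First claim of Proposition 4.1: ‖A_κ − A₀‖²_{HS} → 0 as κ → 0+. -/
theorem stmt_5 (f : ℝ → ℝ) (hf : Measurable f)
    (hint : Integrable (fun x : ℝ => |x| * |f x|)) :
    Filter.Tendsto
      (fun κ : ℝ => ∫ p : ℝ × ℝ,
        (Real.sqrt (|f p.1| * |f p.2|) *
            (Real.exp (-κ * max |p.1| |p.2|) *
              Real.sinh (κ * max 0 (min |p.1| |p.2| * Real.sign (p.1 * p.2))) / κ)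
          - Real.sqrt (|f p.1| * |f p.2|) *
              max 0 (min |p.1| |p.2| * Real.sign (p.1 * p.2))) ^ 2)
      (nhdsWithin 0 (Set.Ioi 0)) (nhds 0) := by
  have hbound : Integrable (fun p : ℝ × ℝ => (|p.1| * |f p.1|) * (|p.2| * |f p.2|)) :=
    hint.mul_prod hint
  have hlim := tendsto_integral_filter_of_dominated_convergence
    (μ := (volume : Measure (ℝ × ℝ)))
    (l := nhdsWithin (0 : ℝ) (Set.Ioi 0))
    (F := fun κ p =>
        (Real.sqrt (|f p.1| * |f p.2|) *
            (Real.exp (-κ * max |p.1| |p.2|) *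
              Real.sinh (κ * max 0 (min |p.1| |p.2| * Real.sign (p.1 * p.2))) / κ)
          - Real.sqrt (|f p.1| * |f p.2|) *
              max 0 (min |p.1| |p.2| * Real.sign (p.1 * p.2))) ^ 2)
    (f := fun _ => (0 : ℝ)) _ ?_ ?_ hbound ?_
  · simpa using hlim
  · refine Filter.Eventually.of_forall fun κ => Measurable.aestronglyMeasurable ?_
    have hsign : Measurable fun p : ℝ × ℝ => Real.sign (p.1 * p.2) :=
      measurable_real_sign.comp (measurable_fst.mul measurable_snd)
    have hsinh : Measurable Real.sinh := Real.continuous_sinh.measurable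
    fun_prop
  · filter_upwards [self_mem_nhdsWithin] with κ (hκ : 0 < κ)
    refine Filter.Eventually.of_forall fun ⟨x, y⟩ => ?_
    have hle := max_zero_min_mul_sign_le_min x y
    have hnonneg : 0 ≤ max 0 (min |x| |y| * Real.sign (x * y)) := le_max_left _ _
    dsimp only
    generalize max 0 (min |x| |y| * Real.sign (x * y)) = l at hle hnonneg ⊢
    have hx : l ≤ |x| := hle.trans (min_le_left _ _)
    have hy : l ≤ |y| := hle.trans (min_le_right _ _)
    obtain ⟨h₀, h₁⟩ := exp_mul_sinh_div_mem_Icc hκ hnonneg (hx.trans (le_max_left |x| |y|))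
    generalize Real.exp (-κ * max |x| |y|) * Real.sinh (κ * l) / κ = a at h₀ h₁ ⊢
    rw [Real.norm_of_nonneg (sq_nonneg _), ← mul_sub, mul_pow, Real.sq_sqrt (by positivity)]
    calc |f x| * |f y| * (a - l) ^ 2 ≤ |f x| * |f y| * (|x| * |y|) := by
          gcongr
          nlinarith [mul_le_mul hx hy hnonneg (abs_nonneg x)]
      _ = |x| * |f x| * (|y| * |f y|) := by ring
  · refine Filter.Eventually.of_forall fun ⟨x, y⟩ => ?_
    have h := (((tendsto_exp_mul_sinh_div (max 0 (min |x| |y| * Real.sign (x * y)))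
      (max |x| |y|)).const_mul (Real.sqrt (|f x| * |f y|))).sub_const
        (Real.sqrt (|f x| * |f y|) * max 0 (min |x| |y| * Real.sign (x * y)))).pow 2
    simpa using h
end

section
/- Let ε > 0 and put ε' := ε/(1+ε). Let f : ℝ → [0,∞) be Lebesgue measurable with ‖f‖_{L¹(ℝ)} < ∞ and ‖f‖_{L^{1+ε}(ℝ)} < ∞, and let c > 0. Then ∫_{ℝ²} f(x) e^{−c|x−x'|} f(x') dx dx' ≤ 2 (ε')^{ε'} c^{−ε'} ‖f‖_{L^{1+ε}(ℝ)} ‖f‖_{L¹(ℝ)}. -/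
open MeasureTheory

theorem integral_exp_neg_mul_abs {a : ℝ} (ha : 0 < a) :
    ∫ x : ℝ, Real.exp (-a * |x|) = 2 / a := by
  rw [integral_comp_abs (f := fun x => Real.exp (-a * x)), integral_exp_mul_Ioi (neg_neg_of_pos ha)]
  simp
  ring

theorem integrable_exp_neg_mul_abs_sub {a : ℝ} (ha : 0 < a) (y : ℝ) :
    Integrable fun x : ℝ => Real.exp (-a * |x - y|) := by
  refine Integrable.comp_sub_right (f := fun x : ℝ => Real.exp (-a * |x|)) ?_ y
  refine .of_integral_ne_zero ?_
  rw [integral_exp_neg_mul_abs ha]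
  positivity

theorem integral_mul_exp_neg_mul_abs_sub_le {p q : ℝ} (hpq : p.HolderConjugate q) {f : ℝ → ℝ}
    (hf : AEStronglyMeasurable f) (hf0 : ∀ x, 0 ≤ f x) (hfp : Integrable fun x => f x ^ p)
    {c : ℝ} (hc : 0 < c) (y : ℝ) :
    ∫ x : ℝ, f x * Real.exp (-c * |x - y|) ≤
      (∫ x : ℝ, f x ^ p) ^ (1 / p) * (2 / (c * q)) ^ (1 / q) := by
  have hcq : 0 < c * q := mul_pos hc hpq.symm.pos
  have hexp : ∀ x : ℝ, Real.exp (-c * |x - y|) ^ q = Real.exp (-(c * q) * |x - y|) := fun x => by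
    rw [← Real.exp_mul]
    ring_nf
  have hmem : MemLp f (ENNReal.ofReal p) := by
    rw [← integrable_norm_rpow_iff hf (by simpa using hpq.pos) ENNReal.ofReal_ne_top]
    simpa [ENNReal.toReal_ofReal hpq.nonneg, abs_of_nonneg (hf0 _)] using hfp
  have hmem' : MemLp (fun x : ℝ => Real.exp (-c * |x - y|)) (ENNReal.ofReal q) := by
    rw [← integrable_norm_rpow_iff (by fun_prop) (by simpa using hpq.symm.pos)
      ENNReal.ofReal_ne_top]
    simp only [ENNReal.toReal_ofReal hpq.symm.nonneg, Real.norm_eq_abs, Real.abs_exp, hexp]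
    exact integrable_exp_neg_mul_abs_sub hcq y
  have holder := integral_mul_le_Lp_mul_Lq_of_nonneg hpq (ae_of_all _ hf0)
    (ae_of_all _ fun x => (Real.exp_pos (-c * |x - y|)).le) hmem hmem'
  simpa only [hexp, integral_sub_right_eq_self (fun x : ℝ => Real.exp (-(c * q) * |x|)) y,
    integral_exp_neg_mul_abs hcq] using holder

/-- Hölder estimate from the proof of Proposition 4.1:
∫∫ f(x) e^{−c|x−x'|} f(x') ≤ 2 (ε')^{ε'} c^{−ε'} ‖f‖_{1+ε} ‖f‖₁ with ε' = ε/(1+ε). -/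
theorem stmt_6 (ε : ℝ) (hε : 0 < ε) (f : ℝ → ℝ) (hf : Measurable f) (hf0 : ∀ x, 0 ≤ f x)
    (h1 : Integrable f) (h2 : Integrable (fun x : ℝ => f x ^ (1 + ε)))
    (c : ℝ) (hc : 0 < c) :
    (∫ p : ℝ × ℝ, f p.1 * Real.exp (-c * |p.1 - p.2|) * f p.2)
      ≤ 2 * (ε / (1 + ε)) ^ (ε / (1 + ε)) * c ^ (-(ε / (1 + ε)))
          * (∫ x : ℝ, f x ^ (1 + ε)) ^ (1 / (1 + ε)) * (∫ x : ℝ, f x) := by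
  have hpq : (1 + ε).HolderConjugate ((1 + ε) / ε) := by
    rw [Real.holderConjugate_iff]
    refine ⟨by linarith, ?_⟩
    field_simp
  have hint : Integrable fun p : ℝ × ℝ => f p.1 * Real.exp (-c * |p.1 - p.2|) * f p.2 := by
    refine (h1.mul_prod h1).mono (by fun_prop) (ae_of_all _ fun p => ?_)
    have hle : Real.exp (-c * |p.1 - p.2|) ≤ 1 :=
      Real.exp_le_one_iff.2 (mul_nonpos_of_nonpos_of_nonneg (by linarith) (abs_nonneg _))
    simp only [norm_mul, Real.norm_eq_abs, Real.abs_exp]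
    gcongr
    exact mul_le_of_le_one_right (abs_nonneg _) hle
  have hconst : (2 / (c * ((1 + ε) / ε))) ^ (1 / ((1 + ε) / ε)) ≤
      2 * (ε / (1 + ε)) ^ (ε / (1 + ε)) * c ^ (-(ε / (1 + ε))) := by
    have he : 0 < ε / (1 + ε) := by positivity
    have he1 : ε / (1 + ε) ≤ 1 := (div_le_one (by positivity)).2 (by linarith)
    have hbase : 2 / (c * ((1 + ε) / ε)) = 2 * (ε / (1 + ε)) * c⁻¹ := by field_simp
    rw [hbase, one_div_div, Real.mul_rpow (by positivity) (by positivity),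
      Real.mul_rpow (by positivity) he.le, Real.inv_rpow hc.le, Real.rpow_neg hc.le]
    gcongr
    exact Real.rpow_le_self_of_one_le one_le_two he1
  have hnorm : 0 ≤ (∫ x : ℝ, f x ^ (1 + ε)) ^ (1 / (1 + ε)) :=
    Real.rpow_nonneg (integral_nonneg fun x => Real.rpow_nonneg (hf0 x) _) _
  rw [Measure.volume_eq_prod] at hint ⊢
  rw [integral_prod_symm _ hint, ← integral_const_mul]
  refine integral_mono hint.integral_prod_right (h1.const_mul _) fun y => ?_
  simp only [integral_mul_const]
  refine mul_le_mul_of_nonneg_right ?_ (hf0 y)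
  calc _ ≤ _ := integral_mul_exp_neg_mul_abs_sub_le hpq hf.aestronglyMeasurable hf0 h2 hc y
    _ ≤ _ := mul_le_mul_of_nonneg_left hconst hnorm
    _ = _ := mul_comm _ _
end

section
/- Let ε > 0, C > 0, let f : ℝ → [0,∞) be Lebesgue measurable with ‖f‖_{L¹(ℝ)} < ∞ and ‖f‖_{L^{1+ε}(ℝ)} < ∞, let (c_n)_{n≥2} be a bounded sequence of nonnegative reals, and let (κ_n)_{n≥2} be reals with κ_n ≥ C·n for all n ≥ 2. Define the kernel N₀(x,x') := (f(x) f(x'))^{1/2} · ∑_{n=2}^∞ (c_n / (2 κ_n)) e^{−κ_n |x−x'|}. Then ∫_{ℝ²} N₀(x,x')² dx dx' < ∞. -/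
open MeasureTheory

/-- An exponential decays faster than any power of order at most one, uniformly on `(0, ∞)`. -/
theorem exp_neg_le_rpow_neg {s x : ℝ} (hs0 : 0 ≤ s) (hs1 : s ≤ 1) (hx : 0 < x) :
    Real.exp (-x) ≤ x ^ (-s) := by
  rw [Real.rpow_def_of_pos hx, Real.exp_le_exp]
  have hlog : Real.log x ≤ x := (Real.log_le_sub_one_of_pos hx).trans (by linarith)
  nlinarith [mul_le_mul_of_nonneg_right hlog hs0]

/-- A Dirichlet-type series with bounded weights and linearly growing exponents is dominated by
any small negative power. -/
theorem exists_tsum_exp_le_rpow {C M s : ℝ} (hC : 0 < C) (hs0 : 0 < s) (hs1 : s ≤ 1)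
    {c κ : ℕ → ℝ} (hc0 : ∀ n, 0 ≤ c n) (hcM : ∀ n, c n ≤ M)
    (hκ : ∀ n : ℕ, 2 ≤ n → C * n ≤ κ n) :
    ∃ A : ℝ, ∀ t : ℝ, 0 < t →
      ∑' n : ℕ, (c (n + 2) / (2 * κ (n + 2))) * Real.exp (-(κ (n + 2)) * t) ≤ A * t ^ (-s) := by
  have hM : 0 ≤ M := (hc0 0).trans (hcM 0)
  let a : ℕ → ℝ := fun n => M / (2 * C) * C ^ (-s) * ((n + 2 : ℕ) : ℝ) ^ (-(1 + s))
  have ha : Summable a :=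
    ((summable_nat_add_iff 2).2 (Real.summable_nat_rpow.2 (by linarith))).mul_left _
  refine ⟨∑' n, a n, fun t ht => ?_⟩
  have hm (n : ℕ) : 0 < ((n + 2 : ℕ) : ℝ) := by positivity
  have hCm (n : ℕ) : 0 < C * ((n + 2 : ℕ) : ℝ) := mul_pos hC (hm n)
  have hκ' (n : ℕ) : C * ((n + 2 : ℕ) : ℝ) ≤ κ (n + 2) := hκ (n + 2) (by omega)
  have hκ0 (n : ℕ) : 0 < κ (n + 2) := (hCm n).trans_le (hκ' n)
  have hle (n : ℕ) : (c (n + 2) / (2 * κ (n + 2))) * Real.exp (-(κ (n + 2)) * t)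
      ≤ a n * t ^ (-s) := by
    have h1 : c (n + 2) / (2 * κ (n + 2)) ≤ M / (2 * (C * ((n + 2 : ℕ) : ℝ))) :=
      div_le_div₀ hM (hcM _) (by linarith [hCm n]) (by linarith [hκ' n])
    have h2 : Real.exp (-(κ (n + 2)) * t) ≤ (C * ((n + 2 : ℕ) : ℝ) * t) ^ (-s) := by
      refine le_trans ?_ (exp_neg_le_rpow_neg hs0.le hs1 (mul_pos (hCm n) ht))
      rw [Real.exp_le_exp, neg_mul, neg_le_neg_iff]
      exact mul_le_mul_of_nonneg_right (hκ' n) ht.le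
    refine (mul_le_mul h1 h2 (Real.exp_pos _).le
      (div_nonneg hM (by linarith [hCm n]))).trans_eq ?_
    simp only [a]
    rw [Real.mul_rpow (hCm n).le ht.le, Real.mul_rpow hC.le (hm n).le, neg_add,
      Real.rpow_add (hm n), Real.rpow_neg_one]
    have := (hm n).ne'
    field_simp
  have hnn (n : ℕ) : 0 ≤ (c (n + 2) / (2 * κ (n + 2))) * Real.exp (-(κ (n + 2)) * t) :=
    mul_nonneg (div_nonneg (hc0 _) (by linarith [hκ0 n])) (Real.exp_pos _).le
  have hb : Summable fun n => a n * t ^ (-s) := ha.mul_right _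
  rw [← tsum_mul_right]
  exact (Summable.of_nonneg_of_le hnn hle hb).tsum_le_tsum hle hb

/-- A pointwise sum of nonnegative measurable real functions is measurable, with the value zero
wherever the series diverges. -/
theorem measurable_tsum_of_nonneg {α : Type*} [MeasurableSpace α] {g : ℕ → α → ℝ}
    (hg : ∀ n, Measurable (g n)) (hg0 : ∀ n x, 0 ≤ g n x) :
    Measurable fun x => ∑' n, g n x := by
  have h : (fun x => ∑' n, g n x) = fun x => (∑' n, ENNReal.ofReal (g n x)).toReal := by
    ext x
    rw [ENNReal.tsum_toReal_eq fun _ => ENNReal.ofReal_ne_top]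
    simp only [ENNReal.toReal_ofReal (hg0 _ x)]
  rw [h]
  exact (Measurable.tsum fun n => (hg n).ennreal_ofReal).ennreal_toReal

/-- The function `|t| ^ r` is integrable near the origin when `r > -1`. -/
theorem integrable_indicator_abs_rpow {r : ℝ} (hr : -1 < r) :
    Integrable fun t : ℝ => (Set.Iio (1 : ℝ)).indicator (fun u => u ^ r) |t| := by
  have h := integrable_fun_norm_addHaar (E := ℝ) volume
    (f := (Set.Iio (1 : ℝ)).indicator fun u => u ^ r)
  simp only [Real.norm_eq_abs] at h
  rw [h]
  simp only [Module.finrank_self, Nat.sub_self, pow_zero, one_smul]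
  rw [IntegrableOn, integrable_indicator_iff measurableSet_Iio, IntegrableOn,
    Measure.restrict_restrict measurableSet_Iio, Set.inter_comm, Set.Ioi_inter_Iio]
  exact (intervalIntegral.integrableOn_Ioo_rpow_iff one_pos).2 hr

/-- The diagonal of the plane is Lebesgue-null. -/
theorem ae_fst_ne_snd : ∀ᵐ p : ℝ × ℝ, p.1 ≠ p.2 := by
  rw [Measure.volume_eq_prod, Measure.ae_prod_iff_ae_ae (p := fun p : ℝ × ℝ => p.1 ≠ p.2)
    (measurableSet_eq_fun measurable_fst measurable_snd).compl]
  filter_upwards with x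
  filter_upwards [Measure.ae_ne volume x] with y hy
  exact hy.symm

/-- The kernel N₀ of Proposition 4.1 is square integrable (Hilbert–Schmidt). -/
theorem stmt_8 (ε C : ℝ) (hε : 0 < ε) (hC : 0 < C)
    (f : ℝ → ℝ) (hfm : Measurable f) (hf0 : ∀ x, 0 ≤ f x)
    (h1 : Integrable f) (h2 : Integrable (fun x : ℝ => f x ^ (1 + ε)))
    (c : ℕ → ℝ) (hc0 : ∀ n, 0 ≤ c n) (hcb : ∃ M : ℝ, ∀ n, c n ≤ M)
    (κ : ℕ → ℝ) (hκ : ∀ n : ℕ, 2 ≤ n → C * n ≤ κ n) :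
    Integrable (fun p : ℝ × ℝ =>
      (Real.sqrt (f p.1 * f p.2) *
          ∑' n : ℕ, (c (n + 2) / (2 * κ (n + 2)))
            * Real.exp (-(κ (n + 2)) * |p.1 - p.2|)) ^ 2) := by
  obtain ⟨M, hcM⟩ := hcb
  set q : ℝ := (1 + ε) / ε with hq
  have hq1 : 1 < q := by rw [hq, lt_div_iff₀ hε]; linarith
  have hpq : (1 + ε).HolderConjugate q := by
    rw [Real.holderConjugate_iff]
    refine ⟨by linarith, ?_⟩
    rw [hq]
    field_simp
  set s : ℝ := 1 / (4 * q) with hs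
  have hs0 : 0 < s := by positivity
  have hs1 : s ≤ 1 := by rw [hs, div_le_one (by linarith)]; linarith
  have hsq : -(2 * s) * q = -(1 / 2) := by rw [hs]; field_simp; norm_num
  obtain ⟨A, hA⟩ := exists_tsum_exp_le_rpow hC hs0 hs1 hc0 hcM hκ
  have hκ0 (n : ℕ) : 0 ≤ κ (n + 2) := le_trans (by positivity) (hκ (n + 2) (by omega))
  have hS0 (n : ℕ) (t : ℝ) : 0 ≤ (c (n + 2) / (2 * κ (n + 2))) * Real.exp (-(κ (n + 2)) * t) :=
    mul_nonneg (div_nonneg (hc0 _) (by linarith [hκ0 n])) (Real.exp_pos _).le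
  have hmeas : Measurable fun p : ℝ × ℝ => (Real.sqrt (f p.1 * f p.2) *
      ∑' n : ℕ, (c (n + 2) / (2 * κ (n + 2)))
        * Real.exp (-(κ (n + 2)) * |p.1 - p.2|)) ^ 2 := by
    refine Measurable.pow_const (Measurable.mul (by fun_prop) ?_) 2
    refine measurable_tsum_of_nonneg (fun n => ?_) fun n p => hS0 n _
    have : Measurable fun p : ℝ × ℝ => |p.1 - p.2| :=
      (continuous_fst.sub continuous_snd).abs.measurable
    fun_prop
  set g : ℝ → ℝ := (Set.Iio (1 : ℝ)).indicator fun u => u ^ (-(1 / 2 : ℝ)) with hg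
  have hgint : Integrable fun t : ℝ => g |t| := integrable_indicator_abs_rpow (by norm_num)
  have hg0 (t : ℝ) (ht : 0 ≤ t) : 0 ≤ g t :=
    Set.indicator_apply_nonneg fun _ => Real.rpow_nonneg ht _
  have hI1 : Integrable fun p : ℝ × ℝ => f p.1 * f p.2 := h1.mul_prod h1
  have hI2 : Integrable fun p : ℝ × ℝ => f p.1 ^ (1 + ε) * f p.2 := h2.mul_prod h1
  have hI3 : Integrable fun p : ℝ × ℝ => f p.2 * g |p.1 - p.2| :=
    h1.convolution_integrand (ContinuousLinearMap.mul ℝ ℝ) hgint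
  refine (((hI1.add hI2).add hI3).const_mul (A ^ 2)).mono' hmeas.aestronglyMeasurable ?_
  filter_upwards [ae_fst_ne_snd] with p hp
  have ht : 0 < |p.1 - p.2| := abs_pos.2 (sub_ne_zero.2 hp)
  simp only [Pi.add_apply]
  set t := |p.1 - p.2|
  have hx := hf0 p.1
  have hy := hf0 p.2
  have hxp : 0 ≤ f p.1 ^ (1 + ε) := Real.rpow_nonneg hx _
  have hgt : 0 ≤ g t := hg0 t ht.le
  have hw : 0 ≤ t ^ (-(2 * s)) := Real.rpow_nonneg ht.le _
  have hsing : f p.1 * t ^ (-(2 * s)) ≤ f p.1 + f p.1 ^ (1 + ε) + g t := by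
    rcases lt_or_ge t 1 with h | h
    · have hyoung := Real.young_inequality_of_nonneg hx hw hpq
      rw [← Real.rpow_mul ht.le, hsq] at hyoung
      have hgt' : g t = t ^ (-(1 / 2 : ℝ)) := Set.indicator_of_mem (Set.mem_Iio.2 h) _
      rw [← hgt'] at hyoung
      have e1 := div_le_self hxp (by linarith : 1 ≤ 1 + ε)
      have e2 := div_le_self hgt hq1.le
      linarith
    · have : t ^ (-(2 * s)) ≤ 1 := Real.rpow_le_one_of_one_le_of_nonpos h (by linarith)
      nlinarith
  have hsum := pow_le_pow_left₀ (tsum_nonneg fun n => hS0 n t) (hA t ht) 2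
  have hpow : (A * t ^ (-s)) ^ 2 = A ^ 2 * t ^ (-(2 * s)) := by
    rw [mul_pow, ← Real.rpow_mul_natCast ht.le]
    congr 2
    push_cast
    ring
  rw [hpow] at hsum
  rw [Real.norm_of_nonneg (sq_nonneg _), mul_pow, Real.sq_sqrt (mul_nonneg hx hy)]
  calc _ ≤ f p.1 * f p.2 * (A ^ 2 * t ^ (-(2 * s))) :=
        mul_le_mul_of_nonneg_left hsum (mul_nonneg hx hy)
    _ = A ^ 2 * f p.2 * (f p.1 * t ^ (-(2 * s))) := by ring
    _ ≤ A ^ 2 * f p.2 * (f p.1 + f p.1 ^ (1 + ε) + g t) :=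
        mul_le_mul_of_nonneg_left hsing (mul_nonneg (sq_nonneg _) hy)
    _ = _ := by ring
end

section
/- Let ε > 0, C > 0, let f : ℝ → [0,∞) be Lebesgue measurable with ‖f‖_{L¹(ℝ)} < ∞ and ‖f‖_{L^{1+ε}(ℝ)} < ∞, let (c_n)_{n≥2} be a bounded sequence of nonnegative reals, and let (κ_n)_{n≥2} be reals with κ_n ≥ C·n for all n ≥ 2. For t ≥ 0 define the kernel N_t(x,x') := (f(x) f(x'))^{1/2} · ∑_{n=2}^∞ (c_n / (2 √(κ_n² + t²))) e^{−√(κ_n² + t²) |x−x'|}. Then ∫_{ℝ²} |N_t(x,x') − N₀(x,x')|² dx dx' → 0 as t → 0+. -/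
open MeasureTheory

theorem Real.exp_neg_le_rpow_neg {y δ : ℝ} (hy : 0 < y) (h0 : 0 ≤ δ) (h1 : δ ≤ 1) :
    Real.exp (-y) ≤ y ^ (-δ) := by
  rw [Real.rpow_def_of_pos hy, Real.exp_le_exp]
  have hlog := Real.log_le_sub_one_of_pos hy
  have h2 : δ * Real.log y ≤ δ * y := mul_le_mul_of_nonneg_left (by linarith) h0
  nlinarith

theorem div_mul_exp_neg_mul_le {c M y s d δ : ℝ} (hc : 0 ≤ c) (hcM : c ≤ M) (hy : 0 < y)
    (hys : y ≤ s) (hd : 0 < d) (h0 : 0 ≤ δ) (h1 : δ ≤ 1) :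
    c / (2 * s) * Real.exp (-s * d) ≤ M / 2 * y ^ (-(1 + δ)) * d ^ (-δ) := by
  have hM : 0 ≤ M := hc.trans hcM
  calc c / (2 * s) * Real.exp (-s * d) ≤ M / (2 * y) * (y * d) ^ (-δ) := by
        refine mul_le_mul (by gcongr) ?_ (Real.exp_pos _).le (by positivity)
        refine le_trans (Real.exp_le_exp.mpr ?_)
          (Real.exp_neg_le_rpow_neg (mul_pos hy hd) h0 h1)
        nlinarith
    _ = M / 2 * y ^ (-(1 + δ)) * d ^ (-δ) := by
        rw [Real.mul_rpow hy.le hd.le, neg_add, Real.rpow_add hy, Real.rpow_neg_one]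
        field_simp

theorem integrable_mul_mul_abs_sub_rpow {f : ℝ → ℝ} {ε : ℝ} (hε : 0 < ε) (hfm : Measurable f)
    (hf0 : ∀ x, 0 ≤ f x) (h1 : Integrable f) (h2 : Integrable (fun x : ℝ => f x ^ (1 + ε))) :
    Integrable (fun p : ℝ × ℝ => f p.1 * f p.2 * |p.1 - p.2| ^ (-(ε / (2 * (1 + ε))))) := by
  set h : ℝ → ℝ := (Set.Ioo 0 1).indicator fun u => u ^ (-(1 / 2) : ℝ) with hh
  have h_int : Integrable h := by
    rw [hh, integrable_indicator_iff measurableSet_Ioo,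
      intervalIntegral.integrableOn_Ioo_rpow_iff one_pos]
    norm_num
  have h_nonneg : ∀ u, 0 ≤ h u := fun u =>
    Set.indicator_nonneg (fun v hv => Real.rpow_nonneg hv.1.le _) u
  have h_conv := h1.convolution_integrand (ContinuousLinearMap.mul ℝ ℝ)
    (h_int.add h_int.comp_neg)
  have h_sum := ((h2.mul_prod h1).add (h1.mul_prod h1)).add h_conv
  refine Integrable.mono' h_sum (by fun_prop) (Filter.Eventually.of_forall fun p => ?_)
  obtain ⟨x, y⟩ := p
  have hx := hf0 x
  have hy := hf0 y
  have hxp : 0 ≤ f x ^ (1 + ε) := Real.rpow_nonneg hx _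
  have hd := abs_nonneg (x - y)
  have hb : 0 ≤ |x - y| ^ (-(ε / (2 * (1 + ε)))) := Real.rpow_nonneg hd _
  rw [Real.norm_of_nonneg (by positivity)]
  simp only [Pi.add_apply, ContinuousLinearMap.mul_apply']
  have key : f x * |x - y| ^ (-(ε / (2 * (1 + ε)))) ≤
      f x ^ (1 + ε) + f x + (h (x - y) + h (-(x - y))) := by
    have hg1 := h_nonneg (x - y)
    have hg2 := h_nonneg (-(x - y))
    rcases hd.eq_or_lt with hd0 | hd0
    · rw [← hd0, Real.zero_rpow (by have : 0 < ε / (2 * (1 + ε)) := by positivity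
                                    linarith), mul_zero]
      positivity
    rcases lt_or_ge |x - y| 1 with hd1 | hd1
    · have hpq : (1 + ε).HolderConjugate ((1 + ε) / ε) := by
        rw [Real.holderConjugate_iff_eq_conjExponent (by linarith)]
        congr 1
        ring
      have hyoung := Real.young_inequality_of_nonneg hx hb hpq
      have hq : (|x - y| ^ (-(ε / (2 * (1 + ε))))) ^ ((1 + ε) / ε) =
          |x - y| ^ (-(1 / 2) : ℝ) := by
        rw [← Real.rpow_mul hd]
        congr 1
        field_simp
      rw [hq] at hyoung
      have e1 : f x ^ (1 + ε) / (1 + ε) ≤ f x ^ (1 + ε) :=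
        div_le_self hxp (by linarith)
      have e2 : |x - y| ^ (-(1 / 2) : ℝ) / ((1 + ε) / ε) ≤ |x - y| ^ (-(1 / 2) : ℝ) :=
        div_le_self (Real.rpow_nonneg hd _) (by rw [le_div_iff₀ hε]; linarith)
      have e3 : |x - y| ^ (-(1 / 2) : ℝ) ≤ h (x - y) + h (-(x - y)) := by
        have e4 : |x - y| ^ (-(1 / 2) : ℝ) = h |x - y| :=
          (Set.indicator_of_mem (s := Set.Ioo (0 : ℝ) 1) ⟨hd0, hd1⟩
            fun u => u ^ (-(1 / 2) : ℝ)).symm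
        rw [e4]
        rcases abs_choice (x - y) with e | e <;> rw [e] <;> linarith
      linarith
    · have : |x - y| ^ (-(ε / (2 * (1 + ε)))) ≤ 1 :=
        Real.rpow_le_one_of_one_le_of_nonpos hd1 (by
          have : 0 < ε / (2 * (1 + ε)) := by positivity
          linarith)
      nlinarith
  nlinarith

theorem ae_fst_sub_snd_ne_zero : ∀ᵐ p : ℝ × ℝ, p.1 - p.2 ≠ 0 :=
  (quasiMeasurePreserving_sub_of_right_invariant (volume : Measure ℝ) volume).ae
    (Measure.ae_ne volume 0)

/-- Second claim of Proposition 4.1: ‖N_t − N₀‖²_{HS} → 0 as t → 0+. -/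
theorem stmt_9 (ε C : ℝ) (hε : 0 < ε) (hC : 0 < C)
    (f : ℝ → ℝ) (hfm : Measurable f) (hf0 : ∀ x, 0 ≤ f x)
    (h1 : Integrable f) (h2 : Integrable (fun x : ℝ => f x ^ (1 + ε)))
    (c : ℕ → ℝ) (hc0 : ∀ n, 0 ≤ c n) (hcb : ∃ M : ℝ, ∀ n, c n ≤ M)
    (κ : ℕ → ℝ) (hκ : ∀ n : ℕ, 2 ≤ n → C * n ≤ κ n) :
    Filter.Tendsto
      (fun t : ℝ => ∫ p : ℝ × ℝ,
        (Real.sqrt (f p.1 * f p.2) *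
            ∑' n : ℕ, (c (n + 2) / (2 * Real.sqrt (κ (n + 2) ^ 2 + t ^ 2)))
              * Real.exp (-(Real.sqrt (κ (n + 2) ^ 2 + t ^ 2)) * |p.1 - p.2|)
          - Real.sqrt (f p.1 * f p.2) *
            ∑' n : ℕ, (c (n + 2) / (2 * κ (n + 2)))
              * Real.exp (-(κ (n + 2)) * |p.1 - p.2|)) ^ 2)
      (nhdsWithin 0 (Set.Ioi 0)) (nhds 0) := by
  obtain ⟨M, hM⟩ := hcb
  set δ : ℝ := ε / (4 * (1 + ε)) with hδ
  have hδ0 : 0 < δ := by positivity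
  have hδ1 : δ ≤ 1 := by rw [hδ, div_le_one (by positivity)]; linarith
  set a : ℕ → ℝ := fun n => M / 2 * (C * ((n + 2 : ℕ) : ℝ)) ^ (-(1 + δ)) with ha
  have ha_sum : Summable a := by
    have hs : Summable fun n : ℕ => (((n + 2 : ℕ) : ℝ)) ^ (-(1 + δ)) :=
      (summable_nat_add_iff (f := fun n : ℕ => (n : ℝ) ^ (-(1 + δ))) 2).2
        (Real.summable_nat_rpow.mpr (by linarith))
    refine ((hs.mul_left (C ^ (-(1 + δ)))).mul_left (M / 2)).congr fun n => ?_
    simp only [ha]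
    rw [Real.mul_rpow hC.le (Nat.cast_nonneg _)]
  have hy (n : ℕ) : 0 < C * ((n + 2 : ℕ) : ℝ) := by positivity
  have hyκ (n : ℕ) : C * ((n + 2 : ℕ) : ℝ) ≤ κ (n + 2) := hκ (n + 2) (by omega)
  have hκ0 (n : ℕ) : 0 < κ (n + 2) := (hy n).trans_le (hyκ n)
  have hκs (n : ℕ) (t : ℝ) : κ (n + 2) ≤ Real.sqrt (κ (n + 2) ^ 2 + t ^ 2) :=
    Real.le_sqrt_of_sq_le (by nlinarith [sq_nonneg t])
  have hbound (n : ℕ) {s d : ℝ} (hs : κ (n + 2) ≤ s) (hd : 0 < d) :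
      0 ≤ c (n + 2) / (2 * s) * Real.exp (-s * d) ∧
      c (n + 2) / (2 * s) * Real.exp (-s * d) ≤ a n * d ^ (-δ) := by
    have hs0 := (hκ0 n).trans_le hs
    have hcn := hc0 (n + 2)
    exact ⟨by positivity, div_mul_exp_neg_mul_le hcn (hM _) (hy n) ((hyκ n).trans hs) hd
      hδ0.le hδ1⟩
  have htsum {s : ℕ → ℝ} {d : ℝ} (hs : ∀ n, κ (n + 2) ≤ s n) (hd : 0 < d) :
      0 ≤ ∑' n, c (n + 2) / (2 * s n) * Real.exp (-s n * d) ∧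
      ∑' n, c (n + 2) / (2 * s n) * Real.exp (-s n * d) ≤ (∑' n, a n) * d ^ (-δ) := by
    have hsum : Summable fun n => a n * d ^ (-δ) := ha_sum.mul_right _
    refine ⟨tsum_nonneg fun n => (hbound n (hs n) hd).1, ?_⟩
    rw [← tsum_mul_right]
    exact (Summable.of_nonneg_of_le (fun n => (hbound n (hs n) hd).1)
      (fun n => (hbound n (hs n) hd).2) hsum).tsum_le_tsum
      (fun n => (hbound n (hs n) hd).2) hsum
  have hlim : (0 : ℝ) = ∫ _ : ℝ × ℝ, (0 : ℝ) := by simp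
  rw [hlim]
  refine tendsto_integral_filter_of_dominated_convergence
    (fun p : ℝ × ℝ => (∑' n, a n) ^ 2 *
      (f p.1 * f p.2 * |p.1 - p.2| ^ (-(ε / (2 * (1 + ε))))))
    (Filter.Eventually.of_forall fun t => ?_) (Filter.Eventually.of_forall fun t => ?_)
    ((integrable_mul_mul_abs_sub_rpow hε hfm hf0 h1 h2).const_mul _) ?_
  · refine Measurable.aestronglyMeasurable ?_
    refine ((Measurable.mul (by fun_prop) (Measurable.tsum fun n => by fun_prop)).sub
      (Measurable.mul (by fun_prop) (Measurable.tsum fun n => by fun_prop))).pow_const 2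
  · filter_upwards [ae_fst_sub_snd_ne_zero] with p hp
    have hd : 0 < |p.1 - p.2| := abs_pos.mpr hp
    obtain ⟨ht0, ht1⟩ := htsum (fun n => hκs n t) hd
    obtain ⟨hz0, hz1⟩ := htsum (s := fun n => κ (n + 2)) (fun n => le_rfl) hd
    have hff : 0 ≤ f p.1 * f p.2 := mul_nonneg (hf0 _) (hf0 _)
    rw [Real.norm_of_nonneg (sq_nonneg _), ← mul_sub, mul_pow, Real.sq_sqrt hff]
    have hsq : |p.1 - p.2| ^ (-(ε / (2 * (1 + ε)))) = (|p.1 - p.2| ^ (-δ)) ^ 2 := by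
      rw [← Real.rpow_natCast, ← Real.rpow_mul hd.le, hδ]
      congr 1
      push_cast
      field_simp
      norm_num
    rw [hsq, mul_left_comm, ← mul_pow]
    refine mul_le_mul_of_nonneg_left (sq_le_sq' ?_ ?_) hff <;> linarith
  · filter_upwards [ae_fst_sub_snd_ne_zero] with p hp
    have hd : 0 < |p.1 - p.2| := abs_pos.mpr hp
    have htend : Filter.Tendsto (fun t : ℝ => ∑' n : ℕ,
        (c (n + 2) / (2 * Real.sqrt (κ (n + 2) ^ 2 + t ^ 2)))
          * Real.exp (-(Real.sqrt (κ (n + 2) ^ 2 + t ^ 2)) * |p.1 - p.2|))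
        (nhdsWithin 0 (Set.Ioi 0))
        (nhds (∑' n : ℕ, (c (n + 2) / (2 * κ (n + 2)))
              * Real.exp (-(κ (n + 2)) * |p.1 - p.2|))) := by
      refine tendsto_tsum_of_dominated_convergence (ha_sum.mul_right (|p.1 - p.2| ^ (-δ)))
        (fun n => ?_) (Filter.Eventually.of_forall fun t n => ?_)
      · have hs : Filter.Tendsto (fun t : ℝ => Real.sqrt (κ (n + 2) ^ 2 + t ^ 2))
            (nhdsWithin 0 (Set.Ioi 0)) (nhds (κ (n + 2))) := by
          have hcont : Continuous fun t : ℝ => Real.sqrt (κ (n + 2) ^ 2 + t ^ 2) := by fun_prop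
          simpa [Real.sqrt_sq (hκ0 n).le] using (hcont.tendsto 0).mono_left nhdsWithin_le_nhds
        exact (tendsto_const_nhds.div (hs.const_mul 2)
          (mul_pos two_pos (hκ0 n)).ne').mul
          ((Real.continuous_exp.tendsto _).comp (hs.neg.mul_const _))
      · rw [Real.norm_of_nonneg (hbound n (hκs n t) hd).1]
        exact (hbound n (hκs n t) hd).2
    have := ((htend.const_mul (Real.sqrt (f p.1 * f p.2))).sub_const (Real.sqrt (f p.1 * f p.2) *
      ∑' n : ℕ, (c (n + 2) / (2 * κ (n + 2))) * Real.exp (-(κ (n + 2)) * |p.1 - p.2|))).pow 2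
    simpa using this
end

section
/- Let f : ℝ → ℝ be Lebesgue measurable with ∫_ℝ (1 + |x|) |f(x)| dx < ∞ and ∫_ℝ f(x) dx = 0. Then ∫_{ℝ²} f(x) |x − x'| f(x') dx dx' ≤ 0. -/
open MeasureTheory

/-- The indicator of the interval between `x` and `y` in terms of indicators of half-lines. -/
lemma indicator_uIoc_eq_halfLines (x y t : ℝ) :
    (Set.uIoc x y).indicator (fun _ => (1 : ℝ)) t =
      (Set.Ici t).indicator (fun _ => (1 : ℝ)) x + (Set.Ici t).indicator (fun _ => (1 : ℝ)) y -
        2 * ((Set.Ici t).indicator (fun _ => (1 : ℝ)) x *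
          (Set.Ici t).indicator (fun _ => (1 : ℝ)) y) := by
  classical
  simp only [Set.indicator_apply, Set.mem_uIoc, Set.mem_Ici]
  grind

/-- The distance between two reals is the integral of the indicator of the interval between
them. -/
lemma integral_indicator_uIoc (x y : ℝ) :
    ∫ t, (Set.uIoc x y).indicator (fun _ => (1 : ℝ)) t = |x - y| := by
  rw [integral_indicator measurableSet_uIoc, setIntegral_const]
  simp [measureReal_def, Real.volume_uIoc, abs_sub_comm]

lemma measurableSet_uIoc_prod :
    MeasurableSet {q : (ℝ × ℝ) × ℝ | q.2 ∈ Set.uIoc q.1.1 q.1.2} := by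
  have hmin : Measurable fun q : (ℝ × ℝ) × ℝ => min q.1.1 q.1.2 := by fun_prop
  have hmax : Measurable fun q : (ℝ × ℝ) × ℝ => max q.1.1 q.1.2 := by fun_prop
  exact (measurableSet_lt hmin measurable_snd).inter (measurableSet_le measurable_snd hmax)

/-- An integrable function with zero integral has nonpositive quadratic form
against `1_{uIoc x y}(t)`, for each `t`. -/
lemma integral_mul_indicator_uIoc_nonpos {f : ℝ → ℝ} (hf : Integrable f)
    (hzero : ∫ x, f x = 0) (t : ℝ) :
    ∫ p : ℝ × ℝ, f p.1 * f p.2 * (Set.uIoc p.1 p.2).indicator (fun _ => (1 : ℝ)) t ≤ 0 := by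
  set g : ℝ → ℝ := (Set.Ici t).indicator f with hg_def
  have hg : Integrable g := hf.indicator measurableSet_Ici
  have key : ∀ p : ℝ × ℝ,
      f p.1 * f p.2 * (Set.uIoc p.1 p.2).indicator (fun _ => (1 : ℝ)) t =
        g p.1 * f p.2 + f p.1 * g p.2 - 2 * (g p.1 * g p.2) := by
    intro p
    have hg' : ∀ x, g x = f x * (Set.Ici t).indicator (fun _ => (1 : ℝ)) x := by
      intro x
      simp [hg_def, Set.indicator_apply]
    rw [indicator_uIoc_eq_halfLines, hg', hg']
    ring
  simp_rw [key]
  have hadd : Integrable (fun p : ℝ × ℝ => g p.1 * f p.2 + f p.1 * g p.2)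
      (volume.prod volume) := (hg.mul_prod hf).add (hf.mul_prod hg)
  rw [Measure.volume_eq_prod, integral_sub hadd ((hg.mul_prod hg).const_mul 2),
    integral_add (hg.mul_prod hf) (hf.mul_prod hg),
    integral_const_mul, integral_prod_mul, integral_prod_mul, integral_prod_mul, hzero]
  nlinarith [mul_self_nonneg (∫ x, g x)]

/-- Sign property used in the borderline case ∫ f = 0 of Theorem 4.8:
∫∫ f(x)|x−x'|f(x') dx dx' ≤ 0. -/
theorem stmt_15 (f : ℝ → ℝ) (hf : Measurable f)
    (hint : Integrable (fun x : ℝ => (1 + |x|) * |f x|))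
    (hzero : (∫ x : ℝ, f x) = 0) :
    (∫ p : ℝ × ℝ, f p.1 * |p.1 - p.2| * f p.2) ≤ 0 := by
  have hmul : Integrable (fun p : ℝ × ℝ => ((1 + |p.1|) * |f p.1|) * ((1 + |p.2|) * |f p.2|)) :=
    hint.mul_prod hint
  have hf_int : Integrable f := by
    refine hint.mono' hf.aestronglyMeasurable (.of_forall fun x => ?_)
    rw [Real.norm_eq_abs]
    nlinarith [abs_nonneg x, abs_nonneg (f x), mul_nonneg (abs_nonneg x) (abs_nonneg (f x))]
  have hkernel : Integrable (fun p : ℝ × ℝ => |f p.1 * f p.2| * |p.1 - p.2|) := by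
    refine hmul.mono' (by fun_prop) (.of_forall fun p => ?_)
    rw [Real.norm_eq_abs, abs_mul, abs_abs, abs_abs, abs_mul]
    have h : |p.1 - p.2| ≤ (1 + |p.1|) * (1 + |p.2|) := by
      nlinarith [abs_sub p.1 p.2, mul_nonneg (abs_nonneg p.1) (abs_nonneg p.2)]
    calc |f p.1| * |f p.2| * |p.1 - p.2|
        ≤ |f p.1| * |f p.2| * ((1 + |p.1|) * (1 + |p.2|)) := by gcongr
      _ = _ := by ring
  set F : ℝ × ℝ → ℝ → ℝ := fun p t =>
    f p.1 * f p.2 * (Set.uIoc p.1 p.2).indicator (fun _ => (1 : ℝ)) t with hF_def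
  have hF_meas : Measurable (Function.uncurry F) := by
    have h : Measurable fun q : (ℝ × ℝ) × ℝ =>
        (Set.uIoc q.1.1 q.1.2).indicator (fun _ => (1 : ℝ)) q.2 :=
      (measurable_const (a := (1 : ℝ))).indicator measurableSet_uIoc_prod
    exact (by fun_prop : Measurable fun q : (ℝ × ℝ) × ℝ => f q.1.1 * f q.1.2).mul h
  have hF_norm : ∀ p t, ‖F p t‖ =
      |f p.1 * f p.2| * (Set.uIoc p.1 p.2).indicator (fun _ => (1 : ℝ)) t := by
    intro p t
    rw [hF_def, Real.norm_eq_abs, abs_mul,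
      abs_of_nonneg (Set.indicator_nonneg (fun _ _ => zero_le_one) t)]
  have hF_int : Integrable (Function.uncurry F) (volume.prod volume) := by
    rw [integrable_prod_iff hF_meas.aestronglyMeasurable]
    refine ⟨.of_forall fun p => ?_, ?_⟩
    · change Integrable fun t =>
        f p.1 * f p.2 * (Set.uIoc p.1 p.2).indicator (fun _ => (1 : ℝ)) t
      refine Integrable.const_mul ?_ _
      refine (integrable_indicator_iff measurableSet_uIoc).2 (integrableOn_const ?_)
      simp [Real.volume_uIoc]
    · simpa only [Function.uncurry_apply_pair, hF_norm, integral_const_mul,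
        integral_indicator_uIoc] using hkernel
  calc (∫ p : ℝ × ℝ, f p.1 * |p.1 - p.2| * f p.2) = ∫ p, ∫ t, F p t := by
        refine integral_congr_ae (.of_forall fun p => ?_)
        simp only [hF_def, integral_const_mul, integral_indicator_uIoc]
        ring
    _ = ∫ t, ∫ p, F p t := integral_integral_swap hF_int
    _ ≤ 0 := integral_nonpos fun t => integral_mul_indicator_uIoc_nonpos hf_int hzero t
end

section
/- Let ε > 0 and put ε' := ε/(1+ε). Let f : ℝ → [0,∞) be Lebesgue measurable with ‖f‖_{L¹(ℝ)} < ∞ and ‖f‖_{L^{1+ε}(ℝ)} < ∞, and let c > 0, σ > 0. Then ∫_{ℝ²} f(x/σ) e^{−c|x−x'|} f(x'/σ) dx dx' ≤ 2 (ε')^{ε'} σ^{2−ε'} c^{−ε'} ‖f‖_{L¹(ℝ)} ‖f‖_{L^{1+ε}(ℝ)}. -/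
open MeasureTheory

theorem integrable_exp_neg_mul_abs {a : ℝ} (ha : 0 < a) :
    Integrable fun x : ℝ => Real.exp (-a * |x|) := by
  refine not_imp_comm.1 integral_undef ?_
  rw [integral_exp_neg_mul_abs ha]
  positivity

theorem memLp_of_integrable_rpow {f : ℝ → ℝ} {p : ℝ} (hp : 0 < p) (hf : Measurable f)
    (hf0 : ∀ x, 0 ≤ f x) (hfp : Integrable fun x => f x ^ p) :
    MemLp f (ENNReal.ofReal p) := by
  rw [← integrable_norm_rpow_iff hf.aestronglyMeasurable (by simpa using hp) (by simp)]
  simpa only [ENNReal.toReal_ofReal hp.le, Real.norm_of_nonneg (hf0 _)] using hfp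

/-- Hölder's inequality for the convolution of `f` with a two-sided exponential. -/
theorem integral_exp_neg_mul_abs_sub_mul_le {p q : ℝ} (hpq : p.HolderConjugate q) {f : ℝ → ℝ}
    (hf : Measurable f) (hf0 : ∀ x, 0 ≤ f x) (hfp : Integrable fun x => f x ^ p)
    {c : ℝ} (hc : 0 < c) (x : ℝ) :
    ∫ y, Real.exp (-c * |x - y|) * f y
      ≤ (2 / (c * q)) ^ (1 / q) * (∫ y, f y ^ p) ^ (1 / p) := by
  have hcq : 0 < c * q := mul_pos hc hpq.symm.pos
  have hpow (y : ℝ) : Real.exp (-c * |x - y|) ^ q = Real.exp (-(c * q) * |x - y|) := by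
    rw [← Real.exp_mul]
    ring_nf
  have hint : Integrable fun y => Real.exp (-c * |x - y|) ^ q := by
    simp only [hpow]
    exact (integrable_exp_neg_mul_abs hcq).comp_sub_left x
  have hval : ∫ y, Real.exp (-c * |x - y|) ^ q = 2 / (c * q) := by
    simp only [hpow]
    rw [integral_sub_left_eq_self (fun y => Real.exp (-(c * q) * |y|)) volume x,
      integral_exp_neg_mul_abs hcq]
  rw [← hval]
  exact integral_mul_le_Lp_mul_Lq_of_nonneg hpq.symm (.of_forall fun _ => (Real.exp_pos _).le)
    (.of_forall hf0)
    (memLp_of_integrable_rpow hpq.symm.pos (by fun_prop) (fun _ => (Real.exp_pos _).le) hint)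
    (memLp_of_integrable_rpow hpq.pos hf hf0 hfp)

theorem integral_mul_exp_neg_mul_abs_sub_mul_le {p q : ℝ} (hpq : p.HolderConjugate q)
    {f : ℝ → ℝ} (hf : Measurable f) (hf0 : ∀ x, 0 ≤ f x) (hf1 : Integrable f)
    (hfp : Integrable fun x => f x ^ p) {c : ℝ} (hc : 0 < c) :
    ∫ z : ℝ × ℝ, f z.1 * Real.exp (-c * |z.1 - z.2|) * f z.2
      ≤ (∫ x, f x) * ((2 / (c * q)) ^ (1 / q) * (∫ x, f x ^ p) ^ (1 / p)) := by
  have hint : Integrable (fun z : ℝ × ℝ => f z.1 * Real.exp (-c * |z.1 - z.2|) * f z.2)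
      (volume.prod volume) := by
    have h := (hf1.mul_prod hf1).bdd_mul (c := 1)
      (f := fun z : ℝ × ℝ => Real.exp (-c * |z.1 - z.2|)) (by fun_prop)
      (.of_forall fun z => by
        rw [Real.norm_of_nonneg (Real.exp_pos _).le, Real.exp_le_one_iff, neg_mul]
        exact neg_nonpos.2 (by positivity))
    exact h.congr (.of_forall fun z => by ring)
  rw [Measure.volume_eq_prod, integral_prod _ hint, ← integral_mul_const]
  refine integral_mono hint.integral_prod_left (hf1.mul_const _) fun x => ?_
  simp only [mul_assoc, integral_const_mul]
  simpa only [mul_assoc] using mul_le_mul_of_nonneg_left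
    (integral_exp_neg_mul_abs_sub_mul_le hpq hf hf0 hfp hc x) (hf0 x)

/-- Scaled Hölder estimate behind ‖N_{α_σ}‖²_{HS} ≤ K₂ σ (equation (5.8)). -/
theorem stmt_17 (ε : ℝ) (hε : 0 < ε) (f : ℝ → ℝ) (hf : Measurable f) (hf0 : ∀ x, 0 ≤ f x)
    (h1 : Integrable f) (h2 : Integrable (fun x : ℝ => f x ^ (1 + ε)))
    (c σ : ℝ) (hc : 0 < c) (hσ : 0 < σ) :
    (∫ p : ℝ × ℝ, f (p.1 / σ) * Real.exp (-c * |p.1 - p.2|) * f (p.2 / σ))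
      ≤ 2 * (ε / (1 + ε)) ^ (ε / (1 + ε)) * σ ^ (2 - ε / (1 + ε)) * c ^ (-(ε / (1 + ε)))
          * (∫ x : ℝ, f x) * (∫ x : ℝ, f x ^ (1 + ε)) ^ (1 / (1 + ε)) := by
  have hp : 1 / (1 + ε) = 1 - ε / (1 + ε) := by field_simp; ring
  have hs1 : ε / (1 + ε) ≤ 1 := (div_le_one (by linarith)).2 (by linarith)
  have hpq : (1 + ε).HolderConjugate (ε / (1 + ε))⁻¹ :=
    Real.holderConjugate_iff.2 ⟨by linarith, by field_simp⟩
  have key := integral_mul_exp_neg_mul_abs_sub_mul_le hpq (f := fun x => f (x / σ))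
    (by fun_prop) (fun x => hf0 _) (h1.comp_div hσ.ne') (h2.comp_div hσ.ne') hc
  rw [Measure.integral_comp_div f, Measure.integral_comp_div (fun x => f x ^ (1 + ε)), hp] at key
  rw [hp]
  have hs : 0 < ε / (1 + ε) := by positivity
  set s := ε / (1 + ε)
  have hI : 0 ≤ ∫ x, f x := integral_nonneg hf0
  have hJ : 0 ≤ ∫ x, f x ^ (1 + ε) := integral_nonneg fun x => Real.rpow_nonneg (hf0 x) _
  have hconst : (2 / (c * s⁻¹)) ^ (1 / s⁻¹) ≤ 2 * s ^ s * c ^ (-s) := by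
    rw [one_div, inv_inv, show 2 / (c * s⁻¹) = 2 * s * c⁻¹ by field_simp,
      Real.mul_rpow (by positivity) (by positivity), Real.mul_rpow (by norm_num) hs.le,
      Real.inv_rpow hc.le, ← Real.rpow_neg hc.le]
    gcongr
    exact Real.rpow_le_self_of_one_le (by norm_num) hs1
  have hpow : σ ^ (2 - s) = σ * σ ^ (1 - s) := by
    rw [← Real.rpow_one_add' hσ.le (by linarith)]
    ring_nf
  refine key.trans ?_
  rw [smul_eq_mul, smul_eq_mul, abs_of_pos hσ, Real.mul_rpow hσ.le hJ, hpow]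
  calc _ ≤ σ * (∫ x, f x) * (2 * s ^ s * c ^ (-s)
        * (σ ^ (1 - s) * (∫ x, f x ^ (1 + ε)) ^ (1 - s))) := by gcongr
    _ = _ := by ring
end

section
/- Let z > 0, let f : ℝ → [0,∞) be Lebesgue integrable, and let P : ℝ² → ℝ be measurable with ‖P‖_{L²(ℝ²)} < ∞. Then ∫_{ℝ²} e^{−z|x|} f(x)^{1/2} ( |x| · |P(x,x')| + |P(x,x')| · |x'| ) e^{−z|x'|} f(x')^{1/2} dx dx' ≤ 2 e^{−1} z^{−1} ‖f‖_{L¹(ℝ)} ‖P‖_{L²(ℝ²)}. -/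
open MeasureTheory

/-- The elementary inequality `x * exp (-x) ≤ exp (-1)`, rescaled by `z > 0`. -/
lemma mul_exp_neg_mul_le {z : ℝ} (hz : 0 < z) (t : ℝ) :
    t * Real.exp (-z * t) ≤ Real.exp (-1) * z⁻¹ := by
  have h1 : z * t ≤ Real.exp (z * t - 1) := by linarith [Real.add_one_le_exp (z * t - 1)]
  have h2 : z * t * Real.exp (-z * t) ≤ Real.exp (-1) := by
    calc z * t * Real.exp (-z * t) ≤ Real.exp (z * t - 1) * Real.exp (-z * t) := by gcongr
      _ = Real.exp (-1) := by rw [← Real.exp_add]; congr 1; ring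
  rw [← div_eq_mul_inv, le_div_iff₀ hz]
  linarith

/-- The two exponentially damped multiplications by the absolute value cost at most
`2 * exp (-1) / z`. -/
lemma exp_mul_abs_add_abs_mul_exp_le {z : ℝ} (hz : 0 < z) (x y : ℝ) :
    Real.exp (-z * |x|) * (|x| + |y|) * Real.exp (-z * |y|) ≤ 2 * Real.exp (-1) * z⁻¹ := by
  have hexp (t : ℝ) : Real.exp (-z * |t|) ≤ 1 :=
    Real.exp_le_one_iff.2 (by nlinarith [abs_nonneg t])
  have hx : |x| * Real.exp (-z * |x|) * Real.exp (-z * |y|) ≤ Real.exp (-1) * z⁻¹ :=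
    (mul_le_of_le_one_right (by positivity) (hexp y)).trans (mul_exp_neg_mul_le hz _)
  have hy : |y| * Real.exp (-z * |y|) * Real.exp (-z * |x|) ≤ Real.exp (-1) * z⁻¹ :=
    (mul_le_of_le_one_right (by positivity) (hexp x)).trans (mul_exp_neg_mul_le hz _)
  linarith

/-- Lemma 4.7 in kernel form. -/
theorem stmt_18 (z : ℝ) (hz : 0 < z) (f : ℝ → ℝ) (hf0 : ∀ x, 0 ≤ f x) (hfi : Integrable f)
    (P : ℝ × ℝ → ℝ) (hPm : Measurable P) (hP2 : Integrable (fun p : ℝ × ℝ => P p ^ 2)) :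
    (∫ p : ℝ × ℝ, Real.exp (-z * |p.1|) * Real.sqrt (f p.1) *
        (|p.1| * |P p| + |P p| * |p.2|) * (Real.exp (-z * |p.2|) * Real.sqrt (f p.2)))
      ≤ 2 * Real.exp (-1) * z⁻¹ * (∫ x : ℝ, f x)
          * Real.sqrt (∫ p : ℝ × ℝ, P p ^ 2) := by
  have hG0 (p : ℝ × ℝ) : 0 ≤ f p.1 * f p.2 := mul_nonneg (hf0 _) (hf0 _)
  have hG : Integrable (fun p : ℝ × ℝ => f p.1 * f p.2) := hfi.mul_prod hfi
  have hg : MemLp (fun p : ℝ × ℝ => √(f p.1 * f p.2)) 2 := by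
    rw [memLp_two_iff_integrable_sq
      (Real.continuous_sqrt.comp_aestronglyMeasurable hG.aestronglyMeasurable)]
    simpa only [Real.sq_sqrt (hG0 _)] using hG
  have hP : MemLp (fun p => |P p|) 2 :=
    ((memLp_two_iff_integrable_sq hPm.aestronglyMeasurable).2 hP2).abs
  have hCS : ∫ p : ℝ × ℝ, |P p| * √(f p.1 * f p.2) ≤
      √(∫ p : ℝ × ℝ, P p ^ 2) * ∫ x, f x := by
    have h := integral_mul_le_Lp_mul_Lq_of_nonneg Real.HolderConjugate.two_two
      (μ := (volume : Measure (ℝ × ℝ))) (f := fun p => |P p|)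
      (g := fun p => √(f p.1 * f p.2))
      (ae_of_all _ fun _ => abs_nonneg _) (ae_of_all _ fun _ => Real.sqrt_nonneg _)
      (by simpa using hP) (by simpa using hg)
    have hmul : ∫ p : ℝ × ℝ, f p.1 * f p.2 = (∫ x, f x) ^ 2 := by
      rw [sq]; exact integral_prod_mul f f
    simpa only [Real.rpow_two, sq_abs, Real.sq_sqrt (hG0 _), ← Real.sqrt_eq_rpow, hmul,
      Real.sqrt_sq (integral_nonneg hf0)] using h
  calc _ ≤ ∫ p : ℝ × ℝ, 2 * Real.exp (-1) * z⁻¹ * (|P p| * √(f p.1 * f p.2)) := by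
        refine integral_mono_of_nonneg (ae_of_all _ fun p => by dsimp only; positivity)
          ((hP.integrable_mul hg).const_mul _) (ae_of_all _ fun p => ?_)
        have h := mul_le_mul_of_nonneg_right (exp_mul_abs_add_abs_mul_exp_le hz p.1 p.2)
          (by positivity : 0 ≤ |P p| * √(f p.1 * f p.2))
        refine le_trans (le_of_eq ?_) h
        rw [Real.sqrt_mul (hf0 _)]
        ring
    _ = 2 * Real.exp (-1) * z⁻¹ * ∫ p : ℝ × ℝ, |P p| * √(f p.1 * f p.2) :=
        integral_const_mul _ _
    _ ≤ 2 * Real.exp (-1) * z⁻¹ * (√(∫ p : ℝ × ℝ, P p ^ 2) * ∫ x, f x) := by gcongr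
    _ = _ := by ring
end
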